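/- Let K be a field and let B, C be finitely generated K-algebras that are integral domains with transcendence degrees d₁ and d₂ over K respectively. Then B ⊗_K C has a domain quotient of transcendence degree d₁ + d₂ over K, and every domain quotient of B ⊗_K C has transcendence degree at most d₁ + d₂; i.e., the Krull dimension of B ⊗_K C is d₁ + d₂. -/

import Mathlib

open scoped TensorProduct

theorem ringKrullDim_eq_of_isIntegral_of_injective {R S : Type*} [CommRing R] [CommRing S]
    (f : R →+* S) (hf : f.IsIntegral) (hinj : Function.Injective f) :
    ringKrullDim R = ringKrullDim S := by
  algebraize [f]
  have hsurj := hf.comap_surjective hinj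
  have : Algebra.HasGoingUp R S := ⟨fun {q} _ P _ hlt ↦ by
    obtain ⟨Q, hPQ, hQ, hQq⟩ := Ideal.exists_ideal_over_prime_of_isIntegral_of_isPrime q P hlt.le
    exact ⟨Q, hPQ, hQ, ⟨hQq.symm⟩⟩⟩
  apply le_antisymm
  · refine iSup_le fun l ↦ ?_
    obtain ⟨P, hP⟩ := hsurj l.head
    have : P.asIdeal.LiesOver l.head.asIdeal := ⟨by rw [← hP]; rfl⟩
    obtain ⟨L, hL, -⟩ := Ideal.exists_ltSeries_of_hasGoingUp l P.asIdeal
    rw [← hL]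
    exact le_iSup (fun L : LTSeries (PrimeSpectrum S) ↦ (L.length : WithBot ℕ∞)) L
  · exact Order.krullDim_le_of_strictMono (PrimeSpectrum.comap (algebraMap R S))
      fun _ _ h ↦ Ideal.IsIntegral.comap_lt_comap h

theorem Algebra.TensorProduct.map_isIntegral {K A B C D : Type*} [CommRing K]
    [CommRing A] [CommRing B] [CommRing C] [CommRing D]
    [Algebra K A] [Algebra K B] [Algebra K C] [Algebra K D]
    {f : A →ₐ[K] B} {g : C →ₐ[K] D} (hf : f.IsIntegral) (hg : g.IsIntegral) :
    (Algebra.TensorProduct.map f g).IsIntegral := by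
  intro z
  induction z using TensorProduct.induction_on with
  | zero => exact RingHom.isIntegralElem_zero _
  | add x y hx hy => exact RingHom.IsIntegralElem.add _ hx hy
  | tmul x y =>
    have hx : (Algebra.TensorProduct.map f g).toRingHom.IsIntegralElem (x ⊗ₜ[K] (1 : D)) := by
      let := f.toRingHom.toAlgebra
      let := (Algebra.TensorProduct.map f g).toRingHom.toAlgebra
      exact IsIntegral.map_of_comp_eq
        (Algebra.TensorProduct.includeLeft : A →ₐ[K] A ⊗[K] C).toRingHom
        (Algebra.TensorProduct.includeLeft : B →ₐ[K] B ⊗[K] D).toRingHom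
        (by ext a; simp [RingHom.algebraMap_toAlgebra]) (hf x)
    have hy : (Algebra.TensorProduct.map f g).toRingHom.IsIntegralElem ((1 : B) ⊗ₜ[K] y) := by
      let := g.toRingHom.toAlgebra
      let := (Algebra.TensorProduct.map f g).toRingHom.toAlgebra
      exact IsIntegral.map_of_comp_eq
        (Algebra.TensorProduct.includeRight : C →ₐ[K] A ⊗[K] C).toRingHom
        (Algebra.TensorProduct.includeRight : D →ₐ[K] B ⊗[K] D).toRingHom
        (by ext a; simp [RingHom.algebraMap_toAlgebra]) (hg y)
    simpa using RingHom.IsIntegralElem.mul _ hx hy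

/-- Noether normalization, with the number of variables given by a transcendence basis. -/
theorem IsTranscendenceBasis.exists_integral_inj_algHom {K B : Type*} [Field K] [CommRing B]
    [IsDomain B] [Algebra K B] [Algebra.FiniteType K B] {d : ℕ} {x : Fin d → B}
    (hx : IsTranscendenceBasis K x) :
    ∃ f : MvPolynomial (Fin d) K →ₐ[K] B, Function.Injective f ∧ f.IsIntegral := by
  obtain ⟨s, f, hinj, hint⟩ := exists_integral_inj_algHom_of_fg K B
  suffices s = d by subst this; exact ⟨f, hinj, hint⟩
  algebraize [f.toRingHom]
  have : IsScalarTower K (MvPolynomial (Fin s) K) B := .of_algHom f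
  have : FaithfulSMul (MvPolynomial (Fin s) K) B :=
    (faithfulSMul_iff_algebraMap_injective _ _).mpr hinj
  have : Algebra.IsIntegral (MvPolynomial (Fin s) K) B := ⟨hint⟩
  have hy := (IsTranscendenceBasis.mvPolynomial (Fin s) K).algebraMap_comp (A := B)
  simpa using hy.lift_cardinalMk_eq hx

/-- If `B`, `C` are finitely generated integral domain algebras over a field `K`, of
transcendence degrees `d₁` and `d₂`, then the Krull dimension of `B ⊗_K C` is `d₁ + d₂`. -/
theorem stmt12 (K B C : Type*) [Field K] [CommRing B] [IsDomain B] [Algebra K B]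
    [CommRing C] [IsDomain C] [Algebra K C]
    (hB : Algebra.FiniteType K B) (hC : Algebra.FiniteType K C)
    (d₁ d₂ : ℕ) (x : Fin d₁ → B) (hx : IsTranscendenceBasis K x)
    (y : Fin d₂ → C) (hy : IsTranscendenceBasis K y) :
    ringKrullDim (B ⊗[K] C) = (d₁ + d₂ : ℕ) := by
  obtain ⟨f, hf, hf'⟩ := hx.exists_integral_inj_algHom
  obtain ⟨g, hg, hg'⟩ := hy.exists_integral_inj_algHom
  have hinj : Function.Injective (Algebra.TensorProduct.map f g) :=
    TensorProduct.map_injective_of_flat_flat f.toLinearMap g.toLinearMap hf hg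
  rw [← ringKrullDim_eq_of_isIntegral_of_injective _
      (Algebra.TensorProduct.map_isIntegral hf' hg') hinj,
    ringKrullDim_eq_of_ringEquiv (MvPolynomial.tensorEquivSum K (Fin d₁) (Fin d₂) K).toRingEquiv,
    MvPolynomial.ringKrullDim_of_isNoetherianRing, ringKrullDim_eq_zero_of_field]
  simp
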